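/- arXiv:2407.15644 — 2 statements merged into one kernel-verified Lean document; each statement's English description precedes it below -/
import Mathlib

section
/- Let K be a number field and let 𝔭 be a prime ideal of O_K not dividing 3 whose residue field has prime cardinality p (i.e. 𝔭 has degree one over ℚ). Let L be a degree-2 extension of K containing a primitive third root of unity ζ, and suppose 𝔭O_L is a prime ideal of O_L (𝔭 is inert in L). Then for all α ∈ O_K: if α ∈ 𝔭 then (α/𝔭O_L)_{L,3} = 0; if α ∉ 𝔭 and p ≡ 2 (mod 3), then (α/𝔭O_L)_{L,3} = 1; and if α ∉ 𝔭 and p ≡ 1 (mod 3), then (α/𝔭O_L)_{L,3} = w², where w is the unique element of {1, ζ, ζ²} with w ≡ α^{(p−1)/3} (mod 𝔭O_L). -/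
open NumberField

/-- The cubic residue symbol `χ γ 𝔞 = (γ/𝔞)_{F,3}` on a ring of integers `R` containing a
primitive third root of unity `ζ`. -/
def IsCubicResidueSymbol {R : Type*} [CommRing R] (ζ : R) (χ : R → Ideal R → R) : Prop :=
  (∀ γ : R, ∀ 𝔮 : Ideal R, 𝔮.IsPrime → (3 : R) ∉ 𝔮 →
    ((γ ∈ 𝔮 → χ γ 𝔮 = 0) ∧
     (γ ∉ 𝔮 → (χ γ 𝔮 = 1 ∨ χ γ 𝔮 = ζ ∨ χ γ 𝔮 = ζ ^ 2) ∧
        χ γ 𝔮 - γ ^ ((Nat.card (R ⧸ 𝔮) - 1) / 3) ∈ 𝔮))) ∧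
  (∀ γ : R, χ γ ⊤ = 1) ∧
  (∀ γ : R, ∀ 𝔞 𝔟 : Ideal R, Ideal.span {(3 : R)} ⊔ 𝔞 = ⊤ → Ideal.span {(3 : R)} ⊔ 𝔟 = ⊤ →
    χ γ (𝔞 * 𝔟) = χ γ 𝔞 * χ γ 𝔟)

/-- Congruent cube roots of unity modulo an ideal not containing `3` are equal. -/
theorem eq_of_pow_three_eq_one_of_sub_mem {R : Type*} [CommRing R] [IsDomain R] {I : Ideal R}
    (hI : (3 : R) ∉ I) {x y : R} (hx : x ^ 3 = 1) (hy : y ^ 3 = 1) (hxy : x - y ∈ I) :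
    x = y := by
  by_contra hne
  have hsum : x ^ 2 + x * y + y ^ 2 = 0 := by
    refine (mul_eq_zero.mp ?_).resolve_left (sub_ne_zero.mpr hne)
    linear_combination hx - hy
  apply hI
  have h : (3 : R) = (x * (2 * x + y)) * (x - y) := by
    linear_combination -3 * hx + x * hsum
  exact h ▸ I.mul_mem_left _ hxy

/-- In a residue ring of prime cardinality `p`, Fermat's little theorem holds. -/
theorem pow_sub_one_mem_of_card_quotient_eq {R : Type*} [CommRing R] {I : Ideal R}
    (hI : I.IsMaximal) {p : ℕ} (hp : p.Prime) (hcard : Nat.card (R ⧸ I) = p) {a : R}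
    (ha : a ∉ I) : a ^ (p - 1) - 1 ∈ I := by
  let _ : Field (R ⧸ I) := Ideal.Quotient.field I
  have : Finite (R ⧸ I) := Nat.finite_of_card_ne_zero (hcard ▸ hp.ne_zero)
  let _ : Fintype (R ⧸ I) := Fintype.ofFinite _
  have h := FiniteField.pow_card_sub_one_eq_one (Ideal.Quotient.mk I a)
    (by rwa [Ne, Ideal.Quotient.eq_zero_iff_mem])
  rw [← Nat.card_eq_fintype_card, hcard] at h
  rw [← Ideal.Quotient.eq_zero_iff_mem]
  simp [h]

/-- An ideal of the ring of integers extended to a finite extension `L / K` has norm raised to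
the power `[L : K]`. -/
theorem card_quotient_map_mapRingHom {K L : Type*} [Field K] [NumberField K] [Field L]
    [NumberField L] [Algebra K L] (I : Ideal (𝓞 K)) :
    Nat.card (𝓞 L ⧸ I.map (RingOfIntegers.mapRingHom (algebraMap K L))) =
      Nat.card (𝓞 K ⧸ I) ^ Module.finrank K L := by
  have h := Ideal.absNorm_algebraMap (𝓞 K) (S := 𝓞 L) I
  rw [← IsFractionRing.finrank_eq (𝓞 K) K (𝓞 L) L] at h
  simp only [Ideal.absNorm_apply, Submodule.cardQuot_apply] at h
  exact h

/-- **Field lowering, inert case** (Lemma 3.3 of the paper).  Let `K` be a number field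
and `𝔭 ∤ 3` a degree-one prime of `O_K` with residue characteristic `p`, and let `L/K` be
quadratic with `ζ₃ ∈ L` and `𝔭` inert in `L`.  Then for `α ∈ O_K`: the symbol
`(α/𝔭O_L)_{L,3}` equals `0` if `α ∈ 𝔭`; equals `1` if `α ∉ 𝔭` and `p ≡ 2 (mod 3)`; and
equals `w²` if `α ∉ 𝔭` and `p ≡ 1 (mod 3)`, where `w ∈ {1, ζ₃, ζ₃²}` is the unique cube
root of unity with `w ≡ α^((p-1)/3) (mod 𝔭O_L)`. -/
theorem stmt_16 (K L : Type*) [Field K] [NumberField K] [Field L] [NumberField L]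
    [Algebra K L] (hdim : Module.finrank K L = 2)
    (ζL : 𝓞 L) (hζ3 : ζL ^ 3 = 1) (hζ1 : ζL ≠ 1)
    (𝔭 : Ideal (𝓞 K)) (h𝔭 : 𝔭.IsPrime) (h𝔭3 : (3 : 𝓞 K) ∉ 𝔭)
    (p : ℕ) (hp : p.Prime) (hcard : Nat.card (𝓞 K ⧸ 𝔭) = p)
    (hinert : (Ideal.map (RingOfIntegers.mapRingHom (algebraMap K L)) 𝔭).IsPrime)
    (α : 𝓞 K)
    (χL : 𝓞 L → Ideal (𝓞 L) → 𝓞 L) (hχL : IsCubicResidueSymbol ζL χL) :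
    (α ∈ 𝔭 →
      χL (RingOfIntegers.mapRingHom (algebraMap K L) α)
        (Ideal.map (RingOfIntegers.mapRingHom (algebraMap K L)) 𝔭) = 0) ∧
    (α ∉ 𝔭 → p % 3 = 2 →
      χL (RingOfIntegers.mapRingHom (algebraMap K L) α)
        (Ideal.map (RingOfIntegers.mapRingHom (algebraMap K L)) 𝔭) = 1) ∧
    (α ∉ 𝔭 → p % 3 = 1 →
      ∀ w : 𝓞 L, (w = 1 ∨ w = ζL ∨ w = ζL ^ 2) →
        w - (RingOfIntegers.mapRingHom (algebraMap K L) α) ^ ((p - 1) / 3) ∈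
          Ideal.map (RingOfIntegers.mapRingHom (algebraMap K L)) 𝔭 →
        χL (RingOfIntegers.mapRingHom (algebraMap K L) α)
          (Ideal.map (RingOfIntegers.mapRingHom (algebraMap K L)) 𝔭) = w ^ 2) := by
  set f := RingOfIntegers.mapRingHom (algebraMap K L)
  set P := Ideal.map f 𝔭
  have hcardP : Nat.card (𝓞 L ⧸ P) = p ^ 2 := by
    rw [card_quotient_map_mapRingHom, hcard, hdim]
  have hmax : 𝔭.IsMaximal := by
    have : Finite (𝓞 K ⧸ 𝔭) := Nat.finite_of_card_ne_zero (hcard ▸ hp.ne_zero)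
    exact Ideal.Quotient.maximal_of_isField _ (Finite.isField_of_domain _)
  have hcomap : P.comap f = 𝔭 :=
    (hmax.eq_of_le (Ideal.comap_ne_top f hinert.ne_top) Ideal.le_comap_map).symm
  have hnot {x : 𝓞 K} (hx : x ∉ 𝔭) : f x ∉ P := fun h ↦ hx (hcomap ▸ Ideal.mem_comap.mpr h)
  have h3P : (3 : 𝓞 L) ∉ P := by simpa only [map_ofNat] using hnot h𝔭3
  have hroot {x : 𝓞 L} (hx : x = 1 ∨ x = ζL ∨ x = ζL ^ 2) : x ^ 3 = 1 := by
    rcases hx with rfl | rfl | rfl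
    · simp
    · exact hζ3
    · rw [← pow_mul, mul_comm, pow_mul, hζ3, one_pow]
  obtain ⟨hzero, hunit⟩ := hχL.1 (f α) P hinert h3P
  have hpp := hp.two_le
  have hχ (hα : α ∉ 𝔭) {w : 𝓞 L} (hw : w ^ 3 = 1)
      (h : f α ^ ((p ^ 2 - 1) / 3) - w ∈ P) : χL (f α) P = w := by
    obtain ⟨hval, hcong⟩ := hunit (hnot hα)
    rw [hcardP] at hcong
    refine eq_of_pow_three_eq_one_of_sub_mem h3P (hroot hval) hw ?_
    simpa using P.add_mem hcong h
  refine ⟨fun hα ↦ hzero (Ideal.mem_map_of_mem f hα), fun hα hp3 ↦ ?_, fun hα hp3 w hw hwα ↦ ?_⟩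
  · refine hχ hα (one_pow 3) ?_
    have hexp : (p ^ 2 - 1) / 3 = (p - 1) * ((p + 1) / 3) := by
      obtain ⟨k, rfl⟩ : ∃ k, p = 3 * k + 2 := ⟨p / 3, by omega⟩
      rw [show (3 * k + 2 + 1) / 3 = k + 1 by omega, show 3 * k + 2 - 1 = 3 * k + 1 by omega]
      apply Nat.div_eq_of_eq_mul_right (by norm_num)
      rw [Nat.sub_eq_iff_eq_add (Nat.one_le_pow _ _ (by omega))]
      ring
    have hfermat : f α ^ (p - 1) - 1 ∈ P := by
      simpa using Ideal.mem_map_of_mem f (pow_sub_one_mem_of_card_quotient_eq hmax hp hcard hα)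
    rw [hexp, pow_mul]
    simpa using P.mem_of_dvd (sub_dvd_pow_sub_pow (f α ^ (p - 1)) 1 ((p + 1) / 3)) hfermat
  · have hw3 := hroot hw
    refine hχ hα (by rw [← pow_mul, mul_comm, pow_mul, hw3, one_pow]) ?_
    obtain ⟨k, rfl⟩ : ∃ k, p = 3 * k + 1 := ⟨p / 3, by omega⟩
    have hexp : ((3 * k + 1) ^ 2 - 1) / 3 = k * (3 * k + 2) := by
      apply Nat.div_eq_of_eq_mul_right (by norm_num)
      rw [Nat.sub_eq_iff_eq_add (Nat.one_le_pow _ _ (by omega))]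
      ring
    have hwpow : w ^ (3 * k + 2) = w ^ 2 := by rw [pow_add, pow_mul, hw3, one_pow, one_mul]
    rw [show (3 * k + 1 - 1) / 3 = k by omega, ← neg_mem_iff, neg_sub] at hwα
    rw [hexp, pow_mul, ← hwpow]
    exact P.mem_of_dvd (sub_dvd_pow_sub_pow _ _ _) hwα
end

section
/- Let K be a number field containing a primitive third root of unity, let L be a degree-2 extension of K, and let 𝔭 be a prime ideal of O_K not dividing 3 that is unramified in L and whose residue field has prime cardinality p with p ≡ 1 (mod 3). Then for all α ∈ O_K, (α/𝔭O_L)_{L,3} = ((α/𝔭)_{K,3})². -/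
open NumberField

/-- Modulo an ideal not containing `3`, distinct cube roots of unity stay distinct. -/
theorem eq_of_sub_mem_of_pow_three_eq_one {R : Type*} [CommRing R] [IsDomain R] {I : Ideal R}
    (h3 : (3 : R) ∉ I) {x y : R} (hx : x ^ 3 = 1) (hy : y ^ 3 = 1) (h : x - y ∈ I) : x = y := by
  by_contra hne
  have hsum : x ^ 2 + x * y + y ^ 2 = 0 := by
    refine (mul_eq_zero.mp ?_).resolve_left (sub_ne_zero.mpr hne)
    linear_combination hx - hy
  refine h3 ?_
  have h3eq : (3 : R) = (x - y) * (-y * (x + 2 * y)) := by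
    linear_combination y * hsum - 3 * hy
  rw [h3eq]
  exact I.mul_mem_right _ h

/-- If `p = 3k + 1`, then `(p ^ f - 1) / 3` is `k` times an integer congruent to `f` mod `3`. -/
theorem exists_pow_sub_one_div_three_eq (k f : ℕ) :
    ∃ m j : ℕ, ((3 * k + 1) ^ f - 1) / 3 = k * m ∧ m = 3 * j + f := by
  suffices h : ∃ m j : ℕ, (3 * k + 1) ^ f = 3 * (k * m) + 1 ∧ m = 3 * j + f by
    obtain ⟨m, j, hm, hj⟩ := h
    exact ⟨m, j, by omega, hj⟩
  induction f with
  | zero => exact ⟨0, 0, by simp, by simp⟩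
  | succ f ih =>
    obtain ⟨m, j, hm, hj⟩ := ih
    refine ⟨m * (3 * k + 1) + 1, j + m * k, ?_, ?_⟩
    · rw [pow_succ, hm]; ring
    · rw [mul_add, mul_one, hj]; ring

namespace IsCubicResidueSymbol

variable {R S : Type*} [CommRing R] [CommRing S] {ζ : R} {χ : R → Ideal R → R}

theorem pow_three_eq_one (hχ : IsCubicResidueSymbol ζ χ) (hζ : ζ ^ 3 = 1) {𝔮 : Ideal R}
    (h𝔮 : 𝔮.IsPrime) (h3 : (3 : R) ∉ 𝔮) {γ : R} (hγ : γ ∉ 𝔮) : χ γ 𝔮 ^ 3 = 1 := by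
  obtain h | h | h := ((hχ.1 γ 𝔮 h𝔮 h3).2 hγ).1
  · rw [h, one_pow]
  · rw [h, hζ]
  · rw [h, pow_right_comm, hζ, one_pow]

/-- The symbol of an element of the smaller ring at a prime of residue degree `f` over a prime of
norm `p` is the `f`-th power of the symbol below. -/
theorem map_eq_pow [IsDomain S] {φ : R →+* S} (hζ : ζ ^ 3 = 1) (hχ : IsCubicResidueSymbol ζ χ)
    {ψ : S → Ideal S → S} (hψ : IsCubicResidueSymbol (φ ζ) ψ) {𝔭 : Ideal R} (h𝔭 : 𝔭.IsPrime)
    (h3 : (3 : R) ∉ 𝔭) {P : Ideal S} (hP : P.IsPrime) (hcomap : P.comap φ = 𝔭) {p f : ℕ}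
    (hp : p % 3 = 1) (hcard : Nat.card (R ⧸ 𝔭) = p) (hcardP : Nat.card (S ⧸ P) = p ^ f)
    (hf : f ≠ 0) (α : R) : ψ (φ α) P = φ (χ α 𝔭) ^ f := by
  have hmem (x : R) : φ x ∈ P ↔ x ∈ 𝔭 := by rw [← hcomap, Ideal.mem_comap]
  have h3P : (3 : S) ∉ P := by
    rw [← map_ofNat φ 3, hmem]
    exact h3
  by_cases hα : α ∈ 𝔭
  · rw [(hψ.1 _ P hP h3P).1 ((hmem α).mpr hα), (hχ.1 α 𝔭 h𝔭 h3).1 hα, map_zero, zero_pow hf]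
  have hαP : φ α ∉ P := (hmem α).not.mpr hα
  have hφχ : φ (χ α 𝔭) ^ 3 = 1 := by
    rw [← map_pow, hχ.pow_three_eq_one hζ h𝔭 h3 hα, map_one]
  refine eq_of_sub_mem_of_pow_three_eq_one h3P
    (hψ.pow_three_eq_one (by rw [← map_pow, hζ, map_one]) hP h3P hαP)
    (by rw [pow_right_comm, hφχ, one_pow]) ?_
  have hup := ((hψ.1 _ P hP h3P).2 hαP).2
  have hdown := (hmem _).mpr ((hχ.1 α 𝔭 h𝔭 h3).2 hα).2
  obtain ⟨k, rfl⟩ : ∃ k, p = 3 * k + 1 := ⟨p / 3, by omega⟩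
  obtain ⟨m, j, hm, hj⟩ := exists_pow_sub_one_div_three_eq k f
  rw [hcardP, hm, pow_mul] at hup
  rw [hcard, map_sub, map_pow, show (3 * k + 1 - 1) / 3 = k by omega] at hdown
  have hpow : φ (χ α 𝔭) ^ f = φ (χ α 𝔭) ^ m := by
    rw [hj, pow_add, pow_mul, hφχ, one_pow, one_mul]
  have hm_mem : φ (χ α 𝔭) ^ m - (φ α ^ k) ^ m ∈ P :=
    P.mem_of_dvd (sub_dvd_pow_sub_pow _ _ m) hdown
  rw [hpow]
  simpa using P.sub_mem hup hm_mem

/-- The symbol of an element of the smaller ring at an ideal all of whose prime factors lie over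
a given prime of norm `p`. -/
theorem map_eq_pow_of_absNorm_eq [IsDedekindDomain S] [Module.Free ℤ S]
    [Module.Finite ℤ S] {φ : R →+* S} (hζ : ζ ^ 3 = 1) (hχ : IsCubicResidueSymbol ζ χ)
    {ψ : S → Ideal S → S} (hψ : IsCubicResidueSymbol (φ ζ) ψ) {𝔭 : Ideal R} [𝔭.IsMaximal]
    (h3 : (3 : R) ∉ 𝔭) {p : ℕ} (hp : p.Prime) (hp3 : p % 3 = 1)
    (hcard : Nat.card (R ⧸ 𝔭) = p) (α : R) (J : Ideal S) (hJ : J ∣ 𝔭.map φ) (n : ℕ)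
    (hn : Ideal.absNorm J = p ^ n) : ψ (φ α) J = φ (χ α 𝔭) ^ n := by
  have hcoprime (I : Ideal S) (hI : I ∣ 𝔭.map φ) : Ideal.span {(3 : S)} ⊔ I = ⊤ := by
    have h : Ideal.span {(3 : R)} ⊔ 𝔭 = ⊤ := by
      refine (Ideal.IsMaximal.out (I := 𝔭)).2 _ (right_lt_sup.mpr ?_)
      rwa [Ideal.span_singleton_le_iff_mem]
    have hmap := congrArg (Ideal.map φ) h
    rw [Ideal.map_sup, Ideal.map_span, Set.image_singleton, map_ofNat, Ideal.map_top] at hmap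
    exact eq_top_mono (sup_le_sup_left (Ideal.le_of_dvd hI) _) hmap
  induction J using UniqueFactorizationMonoid.induction_on_prime generalizing n with
  | h₁ =>
    rw [map_zero] at hn
    exact absurd hn (pow_pos hp.pos n).ne
  | h₂ J hu =>
    rw [Ideal.isUnit_iff] at hu
    subst hu
    rw [Ideal.absNorm_top, eq_comm, Nat.pow_eq_one] at hn
    rw [hn.resolve_left hp.ne_one, pow_zero]
    exact hψ.2.1 _
  | h₃ J P _ hPprime ih =>
    have hPd : P ∣ 𝔭.map φ := (dvd_mul_right P J).trans hJ
    have hJd : J ∣ 𝔭.map φ := (dvd_mul_left J P).trans hJ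
    have hP : P.IsPrime := Ideal.isPrime_of_prime hPprime
    rw [map_mul] at hn
    obtain ⟨f, -, hf⟩ := (Nat.dvd_prime_pow hp).mp (Dvd.intro _ hn)
    obtain ⟨g, -, hg⟩ := (Nat.dvd_prime_pow hp).mp (Dvd.intro_left _ hn)
    have hfg : n = f + g := by
      rw [hf, hg, ← pow_add] at hn
      exact (Nat.pow_right_injective hp.two_le hn).symm
    have hf0 : f ≠ 0 := by
      rintro rfl
      exact hP.ne_top (Ideal.absNorm_eq_one_iff.mp hf)
    have hcomap : P.comap φ = 𝔭 :=
      (Ideal.IsMaximal.eq_of_le ‹_› (hP.comap φ).ne_top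
        (Ideal.map_le_iff_le_comap.mp (Ideal.le_of_dvd hPd))).symm
    rw [hψ.2.2 _ _ _ (hcoprime P hPd) (hcoprime J hJd), ih hJd g hg, hfg, pow_add,
      map_eq_pow hζ hχ hψ inferInstance h3 hP hcomap hp3 hcard hf hf0]

end IsCubicResidueSymbol

/-- **The lowering identity** (combination of Lemmas 3.2 and 3.3 of the paper, as used in
its type I analysis).  Let `K` be a number field containing a primitive third root of
unity `ζ`, `L/K` quadratic, and `𝔭 ∤ 3` a prime of `O_K`, unramified in `L`, whose residue
field has prime cardinality `p ≡ 1 (mod 3)`.  Then for all `α ∈ O_K`,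
`(α/𝔭O_L)_{L,3} = ((α/𝔭)_{K,3})²`. -/
theorem stmt_19 (K L : Type*) [Field K] [NumberField K] [Field L] [NumberField L]
    [Algebra K L] (hdim : Module.finrank K L = 2)
    (ζK : 𝓞 K) (hζ3 : ζK ^ 3 = 1) (hζ1 : ζK ≠ 1)
    (𝔭 : Ideal (𝓞 K)) (h𝔭 : 𝔭.IsPrime) (h𝔭3 : (3 : 𝓞 K) ∉ 𝔭)
    (hunram : ∀ P : Ideal (𝓞 L), P.IsPrime →
      Ideal.map (RingOfIntegers.mapRingHom (algebraMap K L)) 𝔭 ≤ P →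
      ¬ Ideal.map (RingOfIntegers.mapRingHom (algebraMap K L)) 𝔭 ≤ P ^ 2)
    (p : ℕ) (hp : p.Prime) (hcard : Nat.card (𝓞 K ⧸ 𝔭) = p) (hp1 : p % 3 = 1)
    (α : 𝓞 K)
    (χK : 𝓞 K → Ideal (𝓞 K) → 𝓞 K) (hχK : IsCubicResidueSymbol ζK χK)
    (χL : 𝓞 L → Ideal (𝓞 L) → 𝓞 L)
    (hχL : IsCubicResidueSymbol (RingOfIntegers.mapRingHom (algebraMap K L) ζK) χL) :
    χL (RingOfIntegers.mapRingHom (algebraMap K L) α)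
        (Ideal.map (RingOfIntegers.mapRingHom (algebraMap K L)) 𝔭) =
      (RingOfIntegers.mapRingHom (algebraMap K L) (χK α 𝔭)) ^ 2 := by
  have : Finite (𝓞 K ⧸ 𝔭) := Nat.finite_of_card_ne_zero (hcard ▸ hp.ne_zero)
  have : 𝔭.IsMaximal := Ideal.Quotient.maximal_of_isField _ (Finite.isField_of_domain _)
  refine hχK.map_eq_pow_of_absNorm_eq hζ3 hχL h𝔭3 hp hp1 hcard α _ dvd_rfl 2 ?_
  have hnorm := Ideal.absNorm_algebraMap (𝓞 K) (𝓞 L) 𝔭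
  rw [← IsFractionRing.finrank_eq (𝓞 K) K (𝓞 L) L, hdim] at hnorm
  rw [← hcard]
  exact hnorm
end
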